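/- arXiv:2409.12446 — 2 statements merged into one kernel-verified Lean document; each statement's English description precedes it below -/
import Mathlib

section
/- Let α be a measurable space, μ a probability measure on α, n a natural number, ρ and ε real numbers with 0 ≤ ρ, 0 < ε, and 0 < ρ + ε ≤ 1, and H a finite set of functions α → β such that for all f, g ∈ H the set {x : f(x) ≠ g(x)} is measurable. Then μ^{⊗n} of the event {x ∈ α^n : there exist f, g ∈ H with μ{f ≠ g} ≥ ρ + ε such that the number of indices i ∈ {1, …, n} with f(xᵢ) ≠ g(xᵢ) is at most ρ·n} is at most (|H|·(|H| - 1)/2)·exp(-n·ε²/(2·(ρ + ε))). -/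
open MeasureTheory
open scoped ENNReal

lemma nub_exp {t : ℝ} (h0 : 0 ≤ t) (h1 : t ≤ 1) : Real.exp (-t) ≤ 1 - t + t ^ 2 / 2 := by
  have h := Real.exp_bound (x := -t) (by rw [abs_neg, abs_of_nonneg h0]; exact h1) (n := 4) (by norm_num)
  rw [abs_neg, abs_of_nonneg h0] at h
  have h2 := (abs_le.1 h).2
  norm_num [Finset.sum_range_succ, Nat.factorial] at h2
  have h3 : t ^ 4 ≤ t ^ 3 := pow_le_pow_of_le_one h0 h1 (by norm_num)
  have h4 : 0 ≤ t ^ 3 := by positivity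
  nlinarith

open Classical in
lemma nub_chernoff {α : Type*} [MeasurableSpace α] (μ : Measure α)
    [IsProbabilityMeasure μ] (n : ℕ) (ρ ε : ℝ) (hρ : 0 ≤ ρ)
    (hε : 0 < ε) (hρε0 : 0 < ρ + ε) (D : Set α) (hD : MeasurableSet D)
    (hp : ENNReal.ofReal (ρ + ε) ≤ μ D) :
    (Measure.pi fun _ : Fin n => μ)
        {x | (Nat.card {i : Fin n // x i ∈ D} : ℝ) ≤ ρ * n}
      ≤ ENNReal.ofReal (Real.exp (-(n : ℝ) * ε ^ 2 / (2 * (ρ + ε)))) := by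
  have hp' : ρ + ε ≤ μ.real D := (ENNReal.ofReal_le_iff_le_toReal (measure_ne_top _ _)).1 hp
  obtain ⟨t, ht⟩ : ∃ t, t = ε / (ρ + ε) := ⟨_, rfl⟩
  have ht0 : 0 ≤ t := by rw [ht]; positivity
  have ht1 : t ≤ 1 := by rw [ht, div_le_one hρε0]; linarith
  have he := nub_exp ht0 ht1
  have he1 : Real.exp (-t) ≤ 1 := Real.exp_le_one_iff.2 (by linarith)
  let f : α → ℝ := fun y => 1 - D.indicator (fun _ => 1 - Real.exp (-t)) y
  have hf : ∀ y, f y = if y ∈ D then Real.exp (-t) else 1 := by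
    intro y; by_cases h : y ∈ D <;> simp [f, h]
  have hfpos : ∀ y, 0 ≤ f y := by
    intro y; rw [hf]; split_ifs <;> positivity
  have hfle : ∀ y, f y ≤ 1 := by
    intro y; rw [hf]; split_ifs <;> simp [ht0]
  have hfm : Measurable f := by
    exact measurable_const.sub (measurable_const.indicator hD)
  have hfi : ∫ y, f y ∂μ = 1 - μ.real D * (1 - Real.exp (-t)) := by
    rw [integral_sub (integrable_const _) ((integrable_const _).indicator hD),
      integral_indicator_const _ hD]
    simp
  have hI : ∫ x, ∏ i, f (x i) ∂(Measure.pi fun _ : Fin n => μ) =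
      (1 - μ.real D * (1 - Real.exp (-t))) ^ n := by
    rw [← hfi, integral_fintype_prod_eq_pow]
    simp
  have hF : ∀ x : Fin n → α, ∏ i, f (x i) =
      Real.exp (-t * (Nat.card {i : Fin n // x i ∈ D} : ℝ)) := by
    intro x
    simp only [hf]
    rw [Finset.prod_ite]
    simp only [Finset.prod_const, Finset.prod_const_one, mul_one]
    rw [Nat.card_eq_fintype_card, Fintype.card_subtype, ← Real.exp_nat_mul]
    congr 1; ring
  have hFint : Integrable (fun x : Fin n → α => ∏ i, f (x i)) (Measure.pi fun _ : Fin n => μ) := by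
    refine Integrable.of_bound (C := 1) ?_ ?_
    · exact (Finset.measurable_prod _ fun i _ => hfm.comp (measurable_pi_apply i)).aestronglyMeasurable
    · refine Filter.Eventually.of_forall fun x => ?_
      rw [Real.norm_of_nonneg (Finset.prod_nonneg fun i _ => hfpos _)]
      exact Finset.prod_le_one (fun i _ => hfpos _) fun i _ => hfle _
  have hM := mul_meas_ge_le_integral_of_nonneg
    (Filter.Eventually.of_forall fun x => Finset.prod_nonneg fun i _ => hfpos (x i)) hFint
    (Real.exp (-t * (ρ * n)))
  rw [hI] at hM
  have hset : {x : Fin n → α | (Nat.card {i : Fin n // x i ∈ D} : ℝ) ≤ ρ * n} ⊆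
      {x | Real.exp (-t * (ρ * n)) ≤ ∏ i, f (x i)} := by
    intro x hx
    simp only [Set.mem_setOf_eq] at hx ⊢
    rw [hF, Real.exp_le_exp]
    nlinarith
  refine (measure_mono hset).trans ?_
  rw [ENNReal.le_ofReal_iff_toReal_le (measure_ne_top _ _) (Real.exp_pos _).le]
  change Measure.real _ _ ≤ _
  have hb : (1 - μ.real D * (1 - Real.exp (-t))) ^ n ≤
      Real.exp (n * (-(ρ + ε) * (t - t ^ 2 / 2))) := by
    rw [Real.exp_nat_mul]
    refine pow_le_pow_left₀ ?_ ?_ n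
    · rw [← hfi]; exact integral_nonneg hfpos
    · refine le_trans ?_ (Real.add_one_le_exp _)
      have h1 : (ρ + ε) * (1 - Real.exp (-t)) ≤ μ.real D * (1 - Real.exp (-t)) :=
        mul_le_mul_of_nonneg_right hp' (by linarith)
      have h2 : (ρ + ε) * (t - t ^ 2 / 2) ≤ (ρ + ε) * (1 - Real.exp (-t)) :=
        mul_le_mul_of_nonneg_left (by linarith) hρε0.le
      linarith
  have hc : Real.exp (n * (-(ρ + ε) * (t - t ^ 2 / 2))) =
      Real.exp (-t * (ρ * n)) * Real.exp (-(n : ℝ) * ε ^ 2 / (2 * (ρ + ε))) := by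
    rw [← Real.exp_add]
    congr 1
    rw [ht]
    field_simp
    ring
  rw [hc] at hb
  exact le_of_mul_le_mul_left (hM.trans hb) (Real.exp_pos _)

/-- Union bound at the core of the noisy-data generalization theorem: the probability
that some pair `f, g ∈ H` with disagreement measure at least `ρ + ε` disagrees on at
most `ρ·n` of the `n` i.i.d. samples is at most
`(|H|·(|H|-1)/2)·exp(-n·ε²/(2(ρ+ε)))`. -/
theorem noisy_union_bound {α : Type*} [MeasurableSpace α] (μ : Measure α)
    [IsProbabilityMeasure μ] {β : Type*} (n : ℕ) (ρ ε : ℝ) (hρ : 0 ≤ ρ)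
    (hε : 0 < ε) (hρε0 : 0 < ρ + ε) (hρε1 : ρ + ε ≤ 1) (H : Finset (α → β))
    (hmeas : ∀ f ∈ H, ∀ g ∈ H, MeasurableSet {x | f x ≠ g x}) :
    (Measure.pi fun _ : Fin n => μ)
        {x | ∃ f ∈ H, ∃ g ∈ H, ENNReal.ofReal (ρ + ε) ≤ μ {y | f y ≠ g y} ∧
          (Nat.card {i : Fin n // f (x i) ≠ g (x i)} : ℝ) ≤ ρ * n}
      ≤ ((H.card * (H.card - 1) : ℕ) : ℝ≥0∞) / 2 *
          ENNReal.ofReal (Real.exp (-(n : ℝ) * ε ^ 2 / (2 * (ρ + ε)))) := by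
  classical
  set P := Measure.pi fun _ : Fin n => μ
  set E := ENNReal.ofReal (Real.exp (-(n : ℝ) * ε ^ 2 / (2 * (ρ + ε))))
  let A : (α → β) → (α → β) → Set (Fin n → α) := fun f g =>
    {x | ENNReal.ofReal (ρ + ε) ≤ μ {y | f y ≠ g y} ∧
          (Nat.card {i : Fin n // f (x i) ≠ g (x i)} : ℝ) ≤ ρ * n}
  have hA : ∀ f ∈ H, ∀ g ∈ H, P (A f g) ≤ E := by
    intro f hf g hg
    by_cases h : ENNReal.ofReal (ρ + ε) ≤ μ {y | f y ≠ g y}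
    · refine le_trans (measure_mono fun x hx => hx.2)
        (nub_chernoff μ n ρ ε hρ hε hρε0 {y | f y ≠ g y} (hmeas f hf g hg) h)
    · have : A f g = ∅ := by
        ext x; simp only [A, Set.mem_setOf_eq, h, false_and, Set.mem_empty_iff_false]
      rw [this]; simp
  have hself : ∀ f, A f f = ∅ := by
    intro f
    ext x
    simp [A, hρε0]
  have hsymm : ∀ f g, A f g = A g f := by
    intro f g
    ext x
    simp only [A, Set.mem_setOf_eq, ne_comm]
  let B : Finset (α → β) → Set (Fin n → α) := fun s => {x | ∃ f ∈ s, ∃ g ∈ s, x ∈ A f g}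
  have hB : ∀ s ∈ H.powersetCard 2, P (B s) ≤ E := by
    intro s hs
    rw [Finset.mem_powersetCard] at hs
    obtain ⟨f, g, hfg, rfl⟩ := Finset.card_eq_two.1 hs.2
    refine le_trans (measure_mono ?_) (hA f (hs.1 (by simp)) g (hs.1 (by simp)))
    rintro x ⟨a, ha, b, hb, hx⟩
    simp only [Finset.mem_insert, Finset.mem_singleton] at ha hb
    rcases ha with rfl | rfl <;> rcases hb with rfl | rfl
    · rw [hself] at hx; exact hx.elim
    · exact hx
    · rw [hsymm]; exact hx
    · rw [hself] at hx; exact hx.elim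
  have hsub : {x | ∃ f ∈ H, ∃ g ∈ H, ENNReal.ofReal (ρ + ε) ≤ μ {y | f y ≠ g y} ∧
          (Nat.card {i : Fin n // f (x i) ≠ g (x i)} : ℝ) ≤ ρ * n} ⊆
      ⋃ s ∈ H.powersetCard 2, B s := by
    rintro x ⟨f, hf, g, hg, hx⟩
    have hx' : x ∈ A f g := hx
    have hfg : f ≠ g := by
      rintro rfl
      rw [hself] at hx'; exact hx'
    refine Set.mem_biUnion (x := ({f, g} : Finset (α → β))) ?_ ⟨f, by simp, g, by simp, hx'⟩
    simp only [Finset.mem_coe, Finset.mem_powersetCard]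
    refine ⟨?_, Finset.card_pair hfg⟩
    intro a ha
    simp only [Finset.mem_insert, Finset.mem_singleton] at ha
    rcases ha with rfl | rfl <;> assumption
  refine (measure_mono hsub).trans ((measure_biUnion_finset_le _ _).trans
    ((Finset.sum_le_sum hB).trans ?_))
  rw [Finset.sum_const, Finset.card_powersetCard, nsmul_eq_mul]
  refine mul_le_mul_left ?_ _
  rw [ENNReal.le_div_iff_mul_le (by simp) (by simp)]
  have : H.card.choose 2 * 2 ≤ H.card * (H.card - 1) := by
    rw [Nat.choose_two_right]; exact Nat.div_mul_le_self _ _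
  exact_mod_cast this
end

section
/- Let α be a measurable space, μ a probability measure on α, n a natural number, ρ and ε real numbers with 0 ≤ ρ, 0 < ε, and 0 < ρ + ε ≤ 1, H a finite set of functions α → β such that for all f, g ∈ H the set {x : f(x) ≠ g(x)} is measurable, and f* ∈ H. Then μ^{⊗n} of the event {x ∈ α^n : there exists f ∈ H such that the number of indices i ∈ {1, …, n} with f(xᵢ) ≠ f*(xᵢ) is at most ρ·n and μ{f ≠ f*} ≥ ρ + ε} is at most (|H|²/2)·exp(-n·ε²/(2·(ρ + ε))). -/
open MeasureTheory
open scoped ENNReal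

lemma aux_exp_neg {t : ℝ} (ht : 0 ≤ t) : Real.exp (-t) ≤ 1 - t + t ^ 2 / 2 := by
  have h := Real.quadratic_le_exp_of_nonneg ht
  have h1 : Real.exp t * Real.exp (-t) = 1 := by rw [← Real.exp_add]; simp
  have h2 : 0 < Real.exp (-t) := Real.exp_pos _
  have h3 : 0 < 1 + t + t ^ 2 / 2 := by positivity
  have h4 : (1 + t + t ^ 2 / 2) * Real.exp (-t) ≤ 1 := by nlinarith
  have h5 : (1:ℝ) ≤ (1 + t + t ^ 2 / 2) * (1 - t + t ^ 2 / 2) := by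
    nlinarith [sq_nonneg (t ^ 2)]
  exact le_of_mul_le_mul_left (h4.trans h5) h3

lemma aux_tail {α : Type*} [MeasurableSpace α]
    (μ : Measure α) [IsProbabilityMeasure μ] (n : ℕ) (ρ ε : ℝ)
    (hε : 0 < ε) (hq : 0 < ρ + ε) (A : Set α) (hA : MeasurableSet A)
    (hp : ENNReal.ofReal (ρ + ε) ≤ μ A) :
    (Measure.pi fun _ : Fin n => μ)
        {x | (Nat.card {i : Fin n // x i ∈ A} : ℝ) ≤ ρ * n}
      ≤ ENNReal.ofReal (Real.exp (-(n : ℝ) * ε ^ 2 / (2 * (ρ + ε)))) := by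
  classical
  set q := ρ + ε with hqdef
  set t := ε / q with htdef
  have ht : 0 ≤ t := by positivity
  set P := (Measure.pi fun _ : Fin n => μ) with hP
  set g : α → ℝ := fun y => if y ∈ A then Real.exp (-t) else 1 with hg
  have hpr : q ≤ μ.real A := by
    rw [measureReal_def]
    exact (ENNReal.ofReal_le_iff_le_toReal (measure_ne_top _ _)).1 hp
  have hgeq : g = fun y => 1 - A.indicator (fun _ => 1 - Real.exp (-t)) y := by
    funext y
    by_cases hy : y ∈ A <;> simp [hg, hy]
  have hi : Integrable (A.indicator (fun _ : α => 1 - Real.exp (-t))) μ :=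
    (integrable_const _).indicator hA
  have hgi : Integrable g μ := by
    rw [hgeq]
    exact (integrable_const _).sub hi
  have hgint : ∫ y, g y ∂μ = 1 - μ.real A * (1 - Real.exp (-t)) := by
    rw [hgeq, integral_sub (integrable_const _) hi, integral_indicator_const _ hA]
    simp
  have hprod : ∀ x : Fin n → α,
      ∏ i, g (x i) = Real.exp (-t * (Nat.card {i : Fin n // x i ∈ A} : ℝ)) := by
    intro x
    rw [hg]
    simp only
    rw [Finset.prod_ite, Finset.prod_const, Finset.prod_const_one, mul_one, ← Real.exp_nat_mul,
      Nat.card_eq_fintype_card, Fintype.card_subtype, mul_comm]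
  have hM : Real.exp (-t * (ρ * n)) * P.real {x | Real.exp (-t * (ρ * n)) ≤ ∏ i, g (x i)}
      ≤ ∫ x, ∏ i, g (x i) ∂P :=
    mul_meas_ge_le_integral_of_nonneg
      (ae_of_all _ fun x => by
        change 0 ≤ ∏ i, g (x i)
        rw [hprod]; exact (Real.exp_pos _).le)
      (Integrable.fintype_prod (fun _ => hgi)) _
  rw [hP, integral_fintype_prod_eq_pow, ← hP, hgint, Fintype.card_fin] at hM
  have he := aux_exp_neg ht
  have he1 : Real.exp (-t) ≤ 1 := Real.exp_le_one_iff.2 (by linarith)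
  have hb : 1 - μ.real A * (1 - Real.exp (-t)) ≤ Real.exp (-(q * (t - t ^ 2 / 2))) := by
    have h1 := Real.add_one_le_exp (-(q * (t - t ^ 2 / 2)))
    have h2 : q * (1 - Real.exp (-t)) ≤ μ.real A * (1 - Real.exp (-t)) :=
      mul_le_mul_of_nonneg_right hpr (by linarith)
    have h3 : q * (t - t ^ 2 / 2) ≤ q * (1 - Real.exp (-t)) :=
      mul_le_mul_of_nonneg_left (by linarith) hq.le
    linarith
  have hb0 : 0 ≤ 1 - μ.real A * (1 - Real.exp (-t)) := by
    rw [← hgint]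
    refine integral_nonneg fun y => ?_
    simp only [hg, Pi.zero_apply]
    split_ifs <;> positivity
  have hM2 := hM.trans (pow_le_pow_left₀ hb0 hb n)
  rw [← Real.exp_nat_mul] at hM2
  have hfin : P.real {x | Real.exp (-t * (ρ * n)) ≤ ∏ i, g (x i)}
      ≤ Real.exp (-(n : ℝ) * ε ^ 2 / (2 * q)) := by
    refine le_of_mul_le_mul_left (hM2.trans (le_of_eq ?_)) (Real.exp_pos (-t * (ρ * n)))
    rw [← Real.exp_add]
    congr 1
    have hρ' : ρ = q - ε := by rw [hqdef]; ring
    rw [hρ', htdef]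
    field_simp
    ring
  refine (measure_mono ?_).trans
    ((ENNReal.le_ofReal_iff_toReal_le (measure_ne_top P _) (Real.exp_pos _).le).2 hfin)
  intro x hx
  simp only [Set.mem_setOf_eq] at hx ⊢
  rw [hprod, Real.exp_le_exp]
  nlinarith

/-- High-probability form of the corrupted-data generalization theorem (Theorem 6.2):
if the labels come from `f* ∈ H`, then the probability that some `f ∈ H` disagrees
with `f*` on at most `ρ·n` of the `n` i.i.d. samples while having disagreement
measure at least `ρ + ε` is at most `(|H|²/2)·exp(-n·ε²/(2(ρ+ε)))`. -/
theorem noisy_interpolator_generalizes {α : Type*} [MeasurableSpace α]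
    (μ : Measure α) [IsProbabilityMeasure μ] {β : Type*} (n : ℕ) (ρ ε : ℝ)
    (hρ : 0 ≤ ρ) (hε : 0 < ε) (hρε0 : 0 < ρ + ε) (hρε1 : ρ + ε ≤ 1)
    (H : Finset (α → β))
    (hmeas : ∀ f ∈ H, ∀ g ∈ H, MeasurableSet {x | f x ≠ g x})
    (fstar : α → β) (hfstar : fstar ∈ H) :
    (Measure.pi fun _ : Fin n => μ)
        {x | ∃ f ∈ H, (Nat.card {i : Fin n // f (x i) ≠ fstar (x i)} : ℝ) ≤ ρ * n ∧
          ENNReal.ofReal (ρ + ε) ≤ μ {y | f y ≠ fstar y}}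
      ≤ ((H.card : ℝ≥0∞) ^ 2 / 2) *
          ENNReal.ofReal (Real.exp (-(n : ℝ) * ε ^ 2 / (2 * (ρ + ε)))) := by
  classical
  set E := ENNReal.ofReal (Real.exp (-(n : ℝ) * ε ^ 2 / (2 * (ρ + ε)))) with hE
  set P := (Measure.pi fun _ : Fin n => μ) with hP
  have hsub : {x : Fin n → α | ∃ f ∈ H,
        (Nat.card {i : Fin n // f (x i) ≠ fstar (x i)} : ℝ) ≤ ρ * n ∧
          ENNReal.ofReal (ρ + ε) ≤ μ {y | f y ≠ fstar y}} ⊆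
      ⋃ f ∈ H.erase fstar, {x : Fin n → α |
        (Nat.card {i : Fin n // f (x i) ≠ fstar (x i)} : ℝ) ≤ ρ * n ∧
          ENNReal.ofReal (ρ + ε) ≤ μ {y | f y ≠ fstar y}} := by
    rintro x ⟨f, hf, h1, h2⟩
    have hne : f ≠ fstar := by
      rintro rfl
      simp at h2
      linarith
    simp only [Set.mem_iUnion]
    exact ⟨f, Finset.mem_erase.2 ⟨hne, hf⟩, h1, h2⟩
  have hone : ∀ f ∈ H.erase fstar, P {x : Fin n → α |
        (Nat.card {i : Fin n // f (x i) ≠ fstar (x i)} : ℝ) ≤ ρ * n ∧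
          ENNReal.ofReal (ρ + ε) ≤ μ {y | f y ≠ fstar y}} ≤ E := by
    intro f hf
    by_cases hp : ENNReal.ofReal (ρ + ε) ≤ μ {y | f y ≠ fstar y}
    · refine (measure_mono ?_).trans (aux_tail μ n ρ ε hε hρε0 {y | f y ≠ fstar y}
        (hmeas f (Finset.mem_of_mem_erase hf) fstar hfstar) hp)
      exact fun x hx => hx.1
    · simp [hp]
  have hcard : ((H.erase fstar).card : ℝ≥0∞) ≤ (H.card : ℝ≥0∞) ^ 2 / 2 := by
    rw [ENNReal.le_div_iff_mul_le (by simp) (by simp)]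
    have h := Finset.card_erase_add_one hfstar
    rw [← h]
    norm_cast
    nlinarith
  calc P _ ≤ P _ := measure_mono hsub
    _ ≤ ∑ f ∈ H.erase fstar, _ := measure_biUnion_finset_le _ _
    _ ≤ ∑ f ∈ H.erase fstar, E := Finset.sum_le_sum hone
    _ = (H.erase fstar).card * E := by simp
    _ ≤ _ := by gcongr
end
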